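/- arXiv:2205.06422 — 3 statements merged into one kernel-verified Lean document; each statement's English description precedes it below -/
import Mathlib

section
/- For every U in SU(2) (i.e. every 2×2 complex matrix U with U·Uᴴ = I and det U = 1), there exists a matrix O in SO(3) (i.e. a 3×3 real matrix with Oᵀ·O = I and det O = 1) such that for each i ∈ {1,2,3}, U·σᵢ·Uᴴ = Σ_{j=1}^{3} O_{j i} • σⱼ (equality of 2×2 complex matrices, where the real entries O_{j i} act by scalar multiplication). -/
open Matrix

/-- The three Pauli matrices σ₁, σ₂, σ₃. -/
noncomputable def pauli : Fin 3 → Matrix (Fin 2) (Fin 2) ℂ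
  | 0 => !![0, 1; 1, 0]
  | 1 => !![0, -Complex.I; Complex.I, 0]
  | 2 => !![1, 0; 0, -1]

/-- Rotation matrix of the quaternion `w + x i + y j + z k`. -/
def rotQ (w x y z : ℝ) : Matrix (Fin 3) (Fin 3) ℝ :=
  !![w^2+x^2-y^2-z^2, 2*(x*y-z*w), 2*(x*z+y*w);
     2*(x*y+z*w), w^2-x^2+y^2-z^2, 2*(y*z-x*w);
     2*(x*z-y*w), 2*(y*z+x*w), w^2-x^2-y^2+z^2]

theorem rotQ_orth (w x y z : ℝ) (h : w^2+x^2+y^2+z^2 = 1) :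
    (rotQ w x y z)ᵀ * rotQ w x y z = 1 := by
  have h2 : (w^2+x^2+y^2+z^2)^2 = 1 := by rw [h]; norm_num
  ext i j
  fin_cases i <;> fin_cases j <;>
    simp [rotQ, Matrix.mul_apply, Fin.sum_univ_three] <;>
    first | ring1 | linear_combination h2

theorem rotQ_det (w x y z : ℝ) (h : w^2+x^2+y^2+z^2 = 1) :
    (rotQ w x y z).det = 1 := by
  have h2 : (w^2+x^2+y^2+z^2)^3 = 1 := by rw [h]; norm_num
  simp [rotQ, Matrix.det_fin_three]
  linear_combination h2

/-- For every `U ∈ SU(2)` there exists `O ∈ SO(3)` with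
`U σᵢ Uᴴ = ∑ j, O j i • σⱼ` for all `i`. -/
theorem su2_conj_pauli_so3 (U : Matrix (Fin 2) (Fin 2) ℂ)
    (hU : U * Uᴴ = 1) (hdetU : U.det = 1) :
    ∃ O : Matrix (Fin 3) (Fin 3) ℝ, Oᵀ * O = 1 ∧ O.det = 1 ∧
      ∀ i : Fin 3, U * pauli i * Uᴴ = ∑ j : Fin 3, O j i • pauli j := by
  have hadj : Uᴴ = U.adjugate := by
    have h1 : U.adjugate * U = 1 := by rw [Matrix.adjugate_mul, hdetU, one_smul]
    calc Uᴴ = (U.adjugate * U) * Uᴴ := by rw [h1, one_mul]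
      _ = U.adjugate := by rw [mul_assoc, hU, mul_one]
  have e00 := congrFun (congrFun hadj 0) 0
  have e10 := congrFun (congrFun hadj 0) 1
  simp [Matrix.adjugate_fin_two] at e00 e10
  obtain ⟨p, q, hpq⟩ : ∃ p q : ℝ, U 0 0 = p + q * Complex.I :=
    ⟨_, _, (Complex.re_add_im _).symm⟩
  obtain ⟨r, s, hrs⟩ : ∃ r s : ℝ, U 0 1 = r + s * Complex.I :=
    ⟨_, _, (Complex.re_add_im _).symm⟩
  have h11 : U 1 1 = p - q * Complex.I := by
    rw [← e00, hpq]; simp; ring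
  have h10 : U 1 0 = -r + s * Complex.I := by
    have := congrArg (starRingEnd ℂ) e10
    simp [hrs] at this
    rw [this]; ring
  have hI : Complex.I ^ 2 = -1 := Complex.I_sq
  have hn : p^2 + (-s)^2 + (-r)^2 + (-q)^2 = 1 := by
    rw [Matrix.det_fin_two, hpq, hrs, h11, h10] at hdetU
    have : ((p^2 + (-s)^2 + (-r)^2 + (-q)^2 : ℝ) : ℂ) = 1 := by
      push_cast
      linear_combination hdetU + (q^2 + s^2) * hI
    exact_mod_cast this
  refine ⟨rotQ p (-s) (-r) (-q), rotQ_orth _ _ _ _ hn, rotQ_det _ _ _ _ hn, ?_⟩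
  have hUe : U = !![p + q * Complex.I, r + s * Complex.I; -r + s * Complex.I, p - q * Complex.I] := by
    rw [← hpq, ← hrs, ← h11, ← h10]; exact Matrix.eta_fin_two U
  intro i
  rw [hadj, hUe, Matrix.adjugate_fin_two_of]
  ext a b
  fin_cases i <;> fin_cases a <;> fin_cases b <;>
    simp [rotQ, pauli, Matrix.mul_apply, Fin.sum_univ_three, Matrix.sum_apply, Complex.ext_iff, pow_two] <;>
    (try constructor) <;> ring
end

section
/- Let X : Fin α → Fin β → Fin γ → ℝ be a third-order real tensor, let O₁, O₂, O₃ be real matrices of sizes α×α, β×β, γ×γ, and let X′ be the transformed tensor X′_{i j k} = Σ_{p,q,s} (O₁)_{i p}·(O₂)_{j q}·(O₃)_{k s}·X_{p q s}. Then the mode-n unfoldings satisfy X′₍₁₎ = O₁·X₍₁₎·(O₃ ⊗ₖ O₂)ᵀ, X′₍₂₎ = O₂·X₍₂₎·(O₃ ⊗ₖ O₁)ᵀ, and X′₍₃₎ = O₃·X₍₃₎·(O₂ ⊗ₖ O₁)ᵀ, where ⊗ₖ denotes the Kronecker product of matrices. -/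
open Matrix Kronecker

/-- Mode-1 unfolding of a third-order tensor. -/
def unfold1 {α β γ : ℕ} (X : Fin α → Fin β → Fin γ → ℝ) :
    Matrix (Fin α) (Fin γ × Fin β) ℝ :=
  Matrix.of fun i p => X i p.2 p.1

/-- Mode-2 unfolding of a third-order tensor. -/
def unfold2 {α β γ : ℕ} (X : Fin α → Fin β → Fin γ → ℝ) :
    Matrix (Fin β) (Fin γ × Fin α) ℝ :=
  Matrix.of fun j p => X p.2 j p.1

/-- Mode-3 unfolding of a third-order tensor. -/
def unfold3 {α β γ : ℕ} (X : Fin α → Fin β → Fin γ → ℝ) :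
    Matrix (Fin γ) (Fin β × Fin α) ℝ :=
  Matrix.of fun k p => X p.2 p.1 k

/-- The mode-`n` unfoldings of the transformed tensor `(O₁ ⊗ O₂ ⊗ O₃)·X` are
`O₁·X₍₁₎·(O₃ ⊗ₖ O₂)ᵀ`, `O₂·X₍₂₎·(O₃ ⊗ₖ O₁)ᵀ` and `O₃·X₍₃₎·(O₂ ⊗ₖ O₁)ᵀ`. -/
theorem unfold_transform {α β γ : ℕ}
    (X X' : Fin α → Fin β → Fin γ → ℝ)
    (O₁ : Matrix (Fin α) (Fin α) ℝ) (O₂ : Matrix (Fin β) (Fin β) ℝ)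
    (O₃ : Matrix (Fin γ) (Fin γ) ℝ)
    (hX' : ∀ i j k, X' i j k =
      ∑ p, ∑ q, ∑ s, O₁ i p * O₂ j q * O₃ k s * X p q s) :
    unfold1 X' = O₁ * unfold1 X * (O₃ ⊗ₖ O₂)ᵀ ∧
    unfold2 X' = O₂ * unfold2 X * (O₃ ⊗ₖ O₁)ᵀ ∧
    unfold3 X' = O₃ * unfold3 X * (O₂ ⊗ₖ O₁)ᵀ := by
  have h1 : ∀ f : Fin α → Fin β → Fin γ → ℝ,
      ∑ p, ∑ q, ∑ s, f p q s = ∑ q, ∑ p, ∑ s, f p q s := fun f => Finset.sum_comm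
  have h2 : ∀ f : Fin α → Fin β → Fin γ → ℝ,
      ∑ p, ∑ q, ∑ s, f p q s = ∑ s, ∑ p, ∑ q, f p q s := fun f =>
    (Finset.sum_congr rfl fun p _ => Finset.sum_comm).trans Finset.sum_comm
  have h3 : ∀ f : Fin α → Fin β → Fin γ → ℝ,
      ∑ p, ∑ q, ∑ s, f p q s = ∑ s, ∑ q, ∑ p, f p q s := fun f =>
    (h2 f).trans (Finset.sum_congr rfl fun p _ => Finset.sum_comm)
  refine ⟨?_, ?_, ?_⟩
  · ext i ⟨k, j⟩
    simp only [unfold1, Matrix.of_apply, Matrix.mul_apply, Matrix.transpose_apply,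
      Matrix.kroneckerMap_apply, Fintype.sum_prod_type, Finset.sum_mul, hX']
    rw [h3]
    refine Finset.sum_congr rfl fun _ _ => Finset.sum_congr rfl fun _ _ =>
      Finset.sum_congr rfl fun _ _ => ?_
    ring
  · ext j ⟨k, i⟩
    simp only [unfold2, Matrix.of_apply, Matrix.mul_apply, Matrix.transpose_apply,
      Matrix.kroneckerMap_apply, Fintype.sum_prod_type, Finset.sum_mul, hX']
    rw [h2]
    refine Finset.sum_congr rfl fun _ _ => Finset.sum_congr rfl fun _ _ =>
      Finset.sum_congr rfl fun _ _ => ?_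
    ring
  · ext k ⟨j, i⟩
    simp only [unfold3, Matrix.of_apply, Matrix.mul_apply, Matrix.transpose_apply,
      Matrix.kroneckerMap_apply, Fintype.sum_prod_type, Finset.sum_mul, hX']
    rw [h1]
    refine Finset.sum_congr rfl fun _ _ => Finset.sum_congr rfl fun _ _ =>
      Finset.sum_congr rfl fun _ _ => ?_
    ring
end

section
/- Let X : Fin α → Fin β → Fin γ → ℝ be a third-order real tensor, let O₁, O₂, O₃ be real orthogonal matrices of sizes α×α, β×β, γ×γ (Oᵀ·O = I), and let X′ be the transformed tensor X′_{i j k} = Σ_{p,q,s} (O₁)_{i p}·(O₂)_{j q}·(O₃)_{k s}·X_{p q s}. Then for each n ∈ {1,2,3}, the characteristic polynomial of X′₍ₙ₎·(X′₍ₙ₎)ᵀ equals the characteristic polynomial of X₍ₙ₎·(X₍ₙ₎)ᵀ; in particular the singular values of the mode-n unfoldings are invariant under the transformation. -/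
open Matrix

theorem charpoly_aux {m n : Type*} [Fintype m] [Fintype n] [DecidableEq m] [DecidableEq n]
    (A B : Matrix m n ℝ) (O : Matrix m m ℝ) (K : Matrix n n ℝ)
    (hO : Oᵀ * O = 1) (hK : Kᵀ * K = 1) (hB : B = O * (A * Kᵀ)) :
    (B * Bᵀ).charpoly = (A * Aᵀ).charpoly := by
  have h : B * Bᵀ = O * (A * Aᵀ * Oᵀ) := by
    have : B * Bᵀ = O * (A * (Kᵀ * K) * Aᵀ * Oᵀ) := by
      rw [hB]
      simp only [Matrix.transpose_mul, Matrix.transpose_transpose, Matrix.mul_assoc]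
    rw [this, hK, Matrix.mul_one]
  rw [h, Matrix.charpoly_mul_comm, Matrix.mul_assoc, hO, Matrix.mul_one]

theorem kron_aux {m n : Type*} [Fintype m] [Fintype n] [DecidableEq m] [DecidableEq n]
    (P : Matrix m m ℝ) (Q : Matrix n n ℝ) (hP : Pᵀ * P = 1) (hQ : Qᵀ * Q = 1) :
    (Matrix.kroneckerMap (· * ·) P Q)ᵀ * Matrix.kroneckerMap (· * ·) P Q = 1 := by
  have h : (Matrix.kroneckerMap (· * ·) P Q)ᵀ = Matrix.kroneckerMap (· * ·) Pᵀ Qᵀ := rfl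
  rw [h, ← Matrix.mul_kronecker_mul, hP, hQ, Matrix.one_kronecker_one]

/-- The characteristic polynomials of `X₍ₙ₎ X₍ₙ₎ᵀ` (hence the singular values
of the unfoldings) are invariant under the orthogonal transformation
`(O₁ ⊗ O₂ ⊗ O₃)` of the tensor. -/
theorem charpoly_unfold_invariant {α β γ : ℕ}
    (X X' : Fin α → Fin β → Fin γ → ℝ)
    (O₁ : Matrix (Fin α) (Fin α) ℝ) (O₂ : Matrix (Fin β) (Fin β) ℝ)
    (O₃ : Matrix (Fin γ) (Fin γ) ℝ)
    (hO₁ : O₁ᵀ * O₁ = 1) (hO₂ : O₂ᵀ * O₂ = 1) (hO₃ : O₃ᵀ * O₃ = 1)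
    (hX' : ∀ i j k, X' i j k =
      ∑ p, ∑ q, ∑ s, O₁ i p * O₂ j q * O₃ k s * X p q s) :
    (unfold1 X' * (unfold1 X')ᵀ).charpoly = (unfold1 X * (unfold1 X)ᵀ).charpoly ∧
    (unfold2 X' * (unfold2 X')ᵀ).charpoly = (unfold2 X * (unfold2 X)ᵀ).charpoly ∧
    (unfold3 X' * (unfold3 X')ᵀ).charpoly = (unfold3 X * (unfold3 X)ᵀ).charpoly := by
  refine ⟨charpoly_aux _ _ O₁ _ hO₁ (kron_aux O₃ O₂ hO₃ hO₂) ?_,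
    charpoly_aux _ _ O₂ _ hO₂ (kron_aux O₃ O₁ hO₃ hO₁) ?_,
    charpoly_aux _ _ O₃ _ hO₃ (kron_aux O₂ O₁ hO₂ hO₁) ?_⟩
  · ext i ⟨k, j⟩
    simp only [unfold1, Matrix.of_apply, Matrix.mul_apply, Matrix.transpose_apply,
      Matrix.kroneckerMap_apply, Fintype.sum_prod_type, Finset.mul_sum, hX']
    refine Finset.sum_congr rfl fun p _ => ?_
    rw [Finset.sum_comm]
    refine Finset.sum_congr rfl fun s _ => Finset.sum_congr rfl fun q _ => ?_
    ring
  · ext j ⟨k, i⟩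
    simp only [unfold2, Matrix.of_apply, Matrix.mul_apply, Matrix.transpose_apply,
      Matrix.kroneckerMap_apply, Fintype.sum_prod_type, Finset.mul_sum, hX']
    rw [Finset.sum_comm]
    refine Finset.sum_congr rfl fun q _ => ?_
    rw [Finset.sum_comm]
    refine Finset.sum_congr rfl fun s _ => Finset.sum_congr rfl fun p _ => ?_
    ring
  · ext k ⟨j, i⟩
    simp only [unfold3, Matrix.of_apply, Matrix.mul_apply, Matrix.transpose_apply,
      Matrix.kroneckerMap_apply, Fintype.sum_prod_type, Finset.mul_sum, hX']
    rw [Finset.sum_comm]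
    refine (Finset.sum_congr rfl fun q _ => Finset.sum_comm).trans ?_
    rw [Finset.sum_comm]
    refine Finset.sum_congr rfl fun s _ => Finset.sum_congr rfl fun q _ =>
      Finset.sum_congr rfl fun p _ => ?_
    ring
end
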